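/- arXiv:2001.03471 — 4 statements merged into one kernel-verified Lean document; each statement's English description precedes it below -/
import Mathlib

section
/- Let p be an odd prime. Then Σ_{a=1}^{(p−1)/2} a^{p−1} ≡ −1 − (1/2)·p·B_{p−1} + (p/2)·(3/2 + Σ_{k=1}^{(p−3)/2} B_{2k}/(k·2^{2k})) (mod p^2). -/
/-- The number of ascents of a permutation of `Fin n` (positions `i` with `σ i < σ (i+1)`). -/
def numAscents {n : ℕ} (σ : Equiv.Perm (Fin n)) : ℕ :=
  (Finset.univ.filter (fun i : Fin (n - 1) =>
    σ ⟨i.val, by have := i.isLt; omega⟩ < σ ⟨i.val + 1, by have := i.isLt; omega⟩)).card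

/-- The number of permutations of `Fin n` with an even number of ascents. -/
def evenAscentPerms (n : ℕ) : ℕ :=
  (Finset.univ.filter (fun σ : Equiv.Perm (Fin n) => Even (numAscents σ))).card

/-- The Eulerian number `E(n, m)`: permutations of `Fin n` with exactly `m` ascents. -/
def eulerian (n m : ℕ) : ℕ :=
  (Finset.univ.filter (fun σ : Equiv.Perm (Fin n) => numAscents σ = m)).card

/-- `x ≡ 0 (mod p^k)` for a rational `x`: either `x = 0` or the `p`-adic valuation
of `x` is at least `k`. -/
def PadicDvd (p k : ℕ) (x : ℚ) : Prop :=
  x = 0 ∨ (k : ℤ) ≤ padicValRat p x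

open Finset in
theorem sum_range_two_mul_add_one_eq_reflect (f : ℕ → ℤ) (m : ℕ) :
    ∑ a ∈ range (2 * m + 1), f a = f 0 + ∑ j ∈ range m, (f (j + 1) + f (2 * m - j)) := by
  rw [show 2 * m + 1 = m + 1 + m by ring, sum_range_add, sum_range_succ', sum_add_distrib,
    ← sum_range_reflect (fun j => f (m + 1 + j))]
  have h : ∑ j ∈ range m, f (m + 1 + (m - 1 - j)) = ∑ j ∈ range m, f (2 * m - j) := by
    refine sum_congr rfl fun j hj => ?_
    rw [mem_range] at hj
    congr 1
    omega
  rw [h]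
  ring

open Finset in
theorem sum_range_two_mul_add_one_eq_parity (f : ℕ → ℤ) (m : ℕ) :
    ∑ a ∈ range (2 * m + 1), f a =
      f 0 + ∑ j ∈ range m, (f (2 * (j + 1)) + f (2 * m - 1 - 2 * j)) := by
  have h : ∑ j ∈ range m, f (2 * m - 1 - 2 * j) = ∑ j ∈ range m, f (2 * j + 1) := by
    rw [← sum_range_reflect (fun j => f (2 * j + 1))]
    refine sum_congr rfl fun j hj => ?_
    rw [mem_range] at hj
    congr 1
    omega
  rw [sum_add_distrib, h, ← sum_add_distrib]
  clear h
  induction m with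
  | zero => simp
  | succ m ih =>
    rw [show 2 * (m + 1) + 1 = 2 * m + 1 + 1 + 1 by ring, sum_range_succ, sum_range_succ, ih,
      sum_range_succ _ m]
    ring_nf

open Finset in
theorem sum_range_eq_sum_even (f : ℕ → ℚ) (r : ℕ) (hf : ∀ i, Odd i → 1 < i → f i = 0) :
    ∑ i ∈ range (2 * r + 3), f i =
      f 0 + f 1 + ∑ k ∈ Icc 1 r, f (2 * k) + f (2 * r + 2) := by
  induction r with
  | zero => simp [sum_range_succ]
  | succ r ih =>
    rw [show 2 * (r + 1) + 3 = 2 * r + 3 + 1 + 1 by ring, sum_range_succ, sum_range_succ, ih,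
      hf (2 * r + 3) ⟨r + 1, by ring⟩ (by omega), sum_Icc_succ_top (by omega)]
    ring_nf

theorem exists_add_pow_eq_add_sq_mul (x y : ℤ) (n : ℕ) :
    ∃ c : ℤ, (x + y) ^ (n + 1) = x ^ (n + 1) + (n + 1) * x ^ n * y + y ^ 2 * c := by
  induction n with
  | zero => exact ⟨0, by ring⟩
  | succ n ih =>
    obtain ⟨c, hc⟩ := ih
    refine ⟨(n + 1) * x ^ n + c * (x + y), ?_⟩
    rw [pow_succ, hc]
    push_cast
    ring

theorem exists_sub_pow_sub_one_eq {p r : ℕ} (hr : p = 2 * r + 3) (x : ℤ) :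
    ∃ c : ℤ, ((p : ℤ) - x) ^ (2 * r + 2) =
      x ^ (2 * r + 2) + p * x ^ (2 * r + 1) + (p : ℤ) ^ 2 * c := by
  obtain ⟨c, hc⟩ := exists_add_pow_eq_add_sq_mul x (-p) (2 * r + 1)
  refine ⟨c - x ^ (2 * r + 1), ?_⟩
  have he : Even (2 * r + 2) := ⟨r + 1, by ring⟩
  rw [← he.neg_pow, show -((p : ℤ) - x) = x + -p by ring, hc]
  have hp : (p : ℤ) = 2 * r + 3 := by exact_mod_cast hr
  have hr' : (r : ℤ) * 2 = p - 3 := by linarith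
  push_cast
  linear_combination (-x ^ (2 * r + 1) * p) * hr'

open Finset in
theorem exists_sum_range_pow_sub_one_eq_reflect {p r : ℕ} (hr : p = 2 * r + 3) :
    ∃ c : ℤ, ∑ a ∈ range p, (a : ℤ) ^ (2 * r + 2) =
      2 * ∑ j ∈ range (r + 1), ((j : ℤ) + 1) ^ (2 * r + 2) +
        p * ∑ j ∈ range (r + 1), ((j : ℤ) + 1) ^ (2 * r + 1) + (p : ℤ) ^ 2 * c := by
  choose c hc using exists_sub_pow_sub_one_eq hr
  refine ⟨∑ j ∈ range (r + 1), c (j + 1), ?_⟩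
  rw [show range p = range (2 * (r + 1) + 1) by rw [hr]; ring_nf,
    sum_range_two_mul_add_one_eq_reflect (fun a => (a : ℤ) ^ (2 * r + 2))]
  simp only [mul_sum, ← sum_add_distrib]
  rw [Nat.cast_zero, zero_pow (by omega), zero_add]
  refine sum_congr rfl fun j hj => ?_
  rw [mem_range] at hj
  have h : ((2 * (r + 1) - j : ℕ) : ℤ) = p - (j + 1) := by omega
  rw [h, hc]
  push_cast
  ring

open Finset in
theorem exists_sum_range_pow_sub_one_eq_parity {p r : ℕ} (hr : p = 2 * r + 3) :
    ∃ c : ℤ, ∑ a ∈ range p, (a : ℤ) ^ (2 * r + 2) =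
      2 * 2 ^ (2 * r + 2) * ∑ j ∈ range (r + 1), ((j : ℤ) + 1) ^ (2 * r + 2) +
        p * 2 ^ (2 * r + 1) * ∑ j ∈ range (r + 1), ((j : ℤ) + 1) ^ (2 * r + 1) +
          (p : ℤ) ^ 2 * c := by
  choose c hc using exists_sub_pow_sub_one_eq hr
  refine ⟨∑ j ∈ range (r + 1), c (2 * (j + 1)), ?_⟩
  rw [show range p = range (2 * (r + 1) + 1) by rw [hr]; ring_nf,
    sum_range_two_mul_add_one_eq_parity (fun a => (a : ℤ) ^ (2 * r + 2))]
  simp only [mul_sum, ← sum_add_distrib]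
  rw [Nat.cast_zero, zero_pow (by omega), zero_add]
  refine sum_congr rfl fun j hj => ?_
  rw [mem_range] at hj
  have h : ((2 * (r + 1) - 1 - 2 * j : ℕ) : ℤ) = p - 2 * (j + 1) := by omega
  rw [h, hc]
  push_cast
  rw [mul_pow, mul_pow]
  ring

theorem exists_pow_sub_one_eq_one_add {p : ℕ} (hp : p.Prime) {a : ℕ} (ha : 0 < a) (hap : a < p) :
    ∃ e : ℤ, (a : ℤ) ^ (p - 1) = 1 + p * e := by
  have hc : IsCoprime (a : ℤ) p :=
    Nat.isCoprime_iff_coprime.2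
      ((hp.coprime_iff_not_dvd.2 (Nat.not_dvd_of_pos_of_lt ha hap)).symm)
  obtain ⟨e, he⟩ := (Int.ModEq.pow_card_sub_one_eq_one hp hc).symm.dvd
  exact ⟨e, by linarith⟩

open Finset in
theorem exists_two_mul_sum_pow_sub_one_eq {p r : ℕ} (hp : p.Prime) (hr : p = 2 * r + 3) :
    ∃ e : ℤ, 2 * ∑ j ∈ range (r + 1), ((j : ℤ) + 1) ^ (2 * r + 2) = -1 + p * e := by
  have h : ∀ j ∈ range (r + 1), (p : ℤ) ∣ ((j : ℤ) + 1) ^ (2 * r + 2) - 1 := by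
    intro j hj
    rw [mem_range] at hj
    obtain ⟨e, he⟩ := exists_pow_sub_one_eq_one_add hp (a := j + 1) (by omega) (by omega)
    rw [show p - 1 = 2 * r + 2 by omega] at he
    push_cast at he
    exact ⟨e, by rw [he]; ring⟩
  obtain ⟨e, he⟩ := dvd_sum h
  rw [sum_sub_distrib] at he
  simp only [sum_const, card_range, nsmul_eq_mul, mul_one, Nat.cast_add, Nat.cast_one] at he
  have hp' : (p : ℤ) = 2 * r + 3 := by exact_mod_cast hr
  exact ⟨2 * e + 1, by linear_combination 2 * he - hp'⟩

theorem exists_choose_sub_one_eq {p : ℕ} (hp : p.Prime) (i : ℕ) (hi : i < p) :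
    ∃ c : ℤ, ((p - 1).choose i : ℤ) = (-1) ^ i + p * c := by
  induction i with
  | zero => exact ⟨0, by simp⟩
  | succ i ih =>
    obtain ⟨c, hc⟩ := ih (by omega)
    obtain ⟨d, hd⟩ := hp.dvd_choose_self (Nat.succ_ne_zero i) hi
    refine ⟨d - c, ?_⟩
    obtain ⟨n, rfl⟩ : ∃ n, p = n + 1 := ⟨p - 1, by omega⟩
    rw [Nat.succ_eq_add_one, Nat.choose_succ_succ'] at hd
    simp only [Nat.add_sub_cancel] at hc ⊢
    have hd' : ((n.choose i : ℤ)) + n.choose (i + 1) = ((n + 1 : ℕ) : ℤ) * d := by exact_mod_cast hd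
    linear_combination hd' - hc

/-- The subring of `p`-integral rational numbers. -/
abbrev pIntegers (p : ℕ) [Fact p.Prime] : Subring ℚ := (Rat.padicValuation p).integer

section PIntegers

variable {p : ℕ} [Fact p.Prime]

theorem inv_natCast_mem_pIntegers {n : ℕ} (hn : 0 < n) (hnp : n < p) :
    (n : ℚ)⁻¹ ∈ pIntegers p := by
  rw [Valuation.mem_integer_iff, Rat.padicValuation_le_one_iff, Rat.inv_natCast_den_of_pos hn]
  exact Nat.not_dvd_of_pos_of_lt hn hnp

theorem padicDvd_mul_of_mem_pIntegers (k : ℕ) {z : ℚ} (hz : z ∈ pIntegers p) :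
    PadicDvd p k ((p : ℚ) ^ k * z) := by
  rw [Valuation.mem_integer_iff, Rat.padicValuation_le_one_iff] at hz
  have hp : p.Prime := Fact.out
  rcases eq_or_ne z 0 with rfl | h0
  · exact Or.inl (mul_zero _)
  · right
    have hp0 : (p : ℚ) ≠ 0 := by exact_mod_cast hp.ne_zero
    rw [padicValRat.mul (pow_ne_zero _ hp0) h0, padicValRat.pow, padicValRat.self hp.one_lt,
      padicValRat_def, padicValNat.eq_zero_of_not_dvd hz]
    simp

theorem bernoulli'_mem_pIntegers {n : ℕ} (hn : n + 1 < p) : bernoulli' n ∈ pIntegers p := by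
  induction n using Nat.strong_induction_on with
  | _ n ih =>
    rw [bernoulli'_def]
    refine sub_mem (one_mem _) (sum_mem fun k hk => ?_)
    rw [Finset.mem_range] at hk
    refine mul_mem ?_ (ih k hk (by omega))
    rw [div_eq_mul_inv, show (n : ℚ) - k + 1 = ((n - k + 1 : ℕ) : ℚ) by
      push_cast [Nat.cast_sub hk.le]; ring]
    exact mul_mem (natCast_mem _ _) (inv_natCast_mem_pIntegers (by omega) (by omega))

theorem bernoulli_mem_pIntegers {n : ℕ} (hn : n + 1 < p) : bernoulli n ∈ pIntegers p := by
  rw [bernoulli]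
  exact mul_mem (pow_mem (neg_mem (one_mem _)) _) (bernoulli'_mem_pIntegers hn)

open Finset in
theorem exists_sum_range_pow_sub_one_eq_bernoulli {r : ℕ} (hr : p = 2 * r + 3) :
    ∃ z ∈ pIntegers p, ∑ a ∈ range p, (a : ℚ) ^ (2 * r + 2) =
      p * bernoulli (2 * r + 2) + (p : ℚ) ^ 2 * z := by
  have hp : p.Prime := Fact.out
  have hp0 : (p : ℚ) ≠ 0 := by exact_mod_cast hp.ne_zero
  have hterm : ∀ i ∈ range (2 * r + 2), ∃ z ∈ pIntegers p,
      bernoulli i * ((2 * r + 2 + 1).choose i) * (p : ℚ) ^ (2 * r + 2 + 1 - i) /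
        ((2 * r + 2 : ℕ) + 1) = (p : ℚ) ^ 2 * z := by
    intro i hi
    rw [mem_range] at hi
    have hB := bernoulli_mem_pIntegers (p := p) (n := i) (by omega)
    have hden : (((2 * r + 2 : ℕ) : ℚ) + 1) = p := by rw [hr]; push_cast; ring
    rw [hden, show 2 * r + 2 + 1 = p by omega]
    rcases Nat.eq_zero_or_pos i with rfl | hi0
    · refine ⟨(p : ℚ) ^ (2 * r), pow_mem (natCast_mem _ _) _, ?_⟩
      rw [show p - 0 = 2 * r + 3 by omega]
      simp only [bernoulli_zero, Nat.choose_zero_right]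
      field_simp
      push_cast
      ring
    · obtain ⟨d, hd⟩ := hp.dvd_choose_self hi0.ne' (by omega)
      refine ⟨bernoulli i * d * (p : ℚ) ^ (p - i - 2),
        mul_mem (mul_mem hB (natCast_mem _ _)) (pow_mem (natCast_mem _ _) _), ?_⟩
      rw [hd, show p - i = p - i - 2 + 2 by omega]
      simp only [Nat.add_sub_cancel]
      push_cast
      field_simp
      ring
  choose! z hz hz' using hterm
  refine ⟨∑ i ∈ range (2 * r + 2), z i, sum_mem hz, ?_⟩
  rw [sum_range_pow, sum_range_succ, sum_congr rfl hz', ← mul_sum]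
  have hden : (((2 * r + 2 : ℕ) : ℚ) + 1) = p := by rw [hr]; push_cast; ring
  rw [hden, Nat.choose_succ_self_right, Nat.add_sub_cancel_left]
  push_cast at hden ⊢
  rw [hden]
  field_simp
  ring

open Finset in
theorem exists_bernoulli_sum_eq {r : ℕ} (hr : p = 2 * r + 3) :
    ∃ w ∈ pIntegers p, (p : ℚ) = 2 * 2 ^ (2 * r + 2) - p * 2 ^ (2 * r + 1) +
      2 * p * bernoulli (2 * r + 2) -
      p * ∑ k ∈ Icc 1 r, bernoulli (2 * k) / ((k : ℚ) * 2 ^ (2 * k)) + (p : ℚ) ^ 2 * w := by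
  have hp : p.Prime := Fact.out
  have hp0 : (p : ℚ) ≠ 0 := by exact_mod_cast hp.ne_zero
  have hterm : ∀ k ∈ Icc 1 r, ∃ w ∈ pIntegers p,
      bernoulli (2 * k) * (p.choose (2 * k)) * 2 ^ (p - 2 * k) =
        -(p * (bernoulli (2 * k) / ((k : ℚ) * 2 ^ (2 * k)))) + (p : ℚ) ^ 2 * w := by
    intro k hk
    rw [mem_Icc] at hk
    have hB := bernoulli_mem_pIntegers (p := p) (n := 2 * k) (by omega)
    have hk0 : (k : ℚ) ≠ 0 := by exact_mod_cast (by omega : k ≠ 0)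
    obtain ⟨c, hc⟩ := exists_choose_sub_one_eq hp (2 * k - 1) (by omega)
    obtain ⟨e, he⟩ := exists_pow_sub_one_eq_one_add hp (a := 2) (by omega) (by omega)
    have hodd : Odd (2 * k - 1) := ⟨k - 1, by omega⟩
    rw [hodd.neg_one_pow] at hc
    have hcq : ((p - 1).choose (2 * k - 1) : ℚ) = -1 + p * c := by exact_mod_cast hc
    have heq : (2 : ℚ) ^ (p - 1) = 1 + p * e := by exact_mod_cast he
    have hch : (p : ℚ) * (p - 1).choose (2 * k - 1) = p.choose (2 * k) * (2 * k) := by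
      have := Nat.add_one_mul_choose_eq (p - 1) (2 * k - 1)
      rw [show p - 1 + 1 = p by omega, show 2 * k - 1 + 1 = 2 * k by omega] at this
      exact_mod_cast this
    have hpow : (2 : ℚ) ^ (p - 2 * k) * 2 ^ (2 * k) = 2 * (1 + p * e) := by
      rw [← heq, ← pow_add, ← pow_succ']
      congr 1
      omega
    refine ⟨bernoulli (2 * k) * (k : ℚ)⁻¹ * (((2 : ℕ) : ℚ)⁻¹) ^ (2 * k) * (c - e + p * c * e),
      mul_mem (mul_mem (mul_mem hB (inv_natCast_mem_pIntegers (by omega) (by omega)))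
        (pow_mem (inv_natCast_mem_pIntegers (by omega) (by omega)) _))
        (add_mem (sub_mem (intCast_mem _ _) (intCast_mem _ _))
          (mul_mem (mul_mem (natCast_mem _ _) (intCast_mem _ _)) (intCast_mem _ _))), ?_⟩
    rw [hcq] at hch
    have h1 : (p.choose (2 * k) : ℚ) = p * (-1 + p * c) / (2 * k) := by
      rw [eq_div_iff (by positivity), hch]
    have h2 : (2 : ℚ) ^ (p - 2 * k) = 2 * (1 + p * e) / 2 ^ (2 * k) := by
      rw [eq_div_iff (by positivity), hpow]
    rw [h1, h2, inv_pow]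
    push_cast
    field_simp
    ring
  choose! w hw hw' using hterm
  refine ⟨∑ k ∈ Icc 1 r, w k, sum_mem hw, ?_⟩
  have hF := sum_range_pow 2 (2 * r + 2)
  have hden : (((2 * r + 2 : ℕ) : ℚ) + 1) = p := by rw [hr]; push_cast; ring
  rw [hden, ← sum_div, eq_div_iff hp0, show 2 * r + 2 + 1 = p by omega] at hF
  simp only [Nat.cast_ofNat] at hF
  have hF' := sum_range_eq_sum_even
    (fun i => bernoulli i * (p.choose i : ℚ) * 2 ^ (p - i)) r
    (fun i hi hi1 => by simp [bernoulli_eq_zero_of_odd hi hi1])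
  rw [← hr, ← hF] at hF'
  have hlast : p.choose (2 * r + 2) = p := by
    rw [show 2 * r + 2 = p - 1 by omega, ← Nat.choose_symm (by omega),
      show p - (p - 1) = 1 by omega, Nat.choose_one_right]
  simp only [hlast] at hF'
  rw [sum_congr rfl hw', sum_add_distrib, sum_neg_distrib, ← mul_sum, ← mul_sum,
    show p - 0 = 2 * r + 2 + 1 by omega, show p - 1 = 2 * r + 1 + 1 by omega,
    show p - (2 * r + 2) = 1 by omega] at hF'
  simp only [sum_range_succ, sum_range_zero, bernoulli_zero, bernoulli_one,
    Nat.choose_zero_right, Nat.choose_one_right, Nat.cast_zero, Nat.cast_one, one_pow,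
    zero_pow (show 2 * r + 2 ≠ 0 by omega)] at hF'
  linear_combination hF'

end PIntegers

theorem sum_p_sub_one_powers_first_half_mod_p_sq
    (p : ℕ) (hp : p.Prime) (hodd : Odd p) :
    PadicDvd p 2 ((∑ a ∈ Finset.Icc 1 ((p - 1) / 2), (a : ℚ) ^ (p - 1)) -
      (-1 - (1 / 2) * (p : ℚ) * bernoulli (p - 1) + ((p : ℚ) / 2) *
        (3 / 2 + ∑ k ∈ Finset.Icc 1 ((p - 3) / 2),
          bernoulli (2 * k) / ((k : ℚ) * 2 ^ (2 * k))))) := by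
  have : Fact p.Prime := ⟨hp⟩
  have hp2 := hp.two_le
  obtain ⟨r, hr⟩ : ∃ r, p = 2 * r + 3 := by
    obtain ⟨m, hm⟩ := hodd
    exact ⟨m - 1, by omega⟩
  obtain ⟨c, hc⟩ := exists_sum_range_pow_sub_one_eq_reflect hr
  obtain ⟨d, hd⟩ := exists_sum_range_pow_sub_one_eq_parity hr
  obtain ⟨e, he⟩ := exists_two_mul_sum_pow_sub_one_eq hp hr
  obtain ⟨q, hq⟩ := exists_pow_sub_one_eq_one_add hp (a := 2) (by omega) (by omega)
  obtain ⟨z, hz, hU⟩ := exists_sum_range_pow_sub_one_eq_bernoulli hr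
  obtain ⟨w, hw, hL⟩ := exists_bernoulli_sum_eq hr
  rw [show (p - 1) / 2 = r + 1 by omega, show (p - 3) / 2 = r by omega,
    show p - 1 = 2 * r + 2 by omega]
  rw [show p - 1 = 2 * r + 2 by omega] at hq
  have hS : ∑ a ∈ Finset.Icc 1 (r + 1), (a : ℚ) ^ (2 * r + 2) =
      ((∑ j ∈ Finset.range (r + 1), ((j : ℤ) + 1) ^ (2 * r + 2) : ℤ) : ℚ) := by
    rw [← Finset.Ico_add_one_right_eq_Icc, Finset.sum_Ico_eq_sum_range]
    push_cast
    exact Finset.sum_congr rfl fun j _ => by rw [add_comm]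
  rw [hS]
  generalize ∑ j ∈ Finset.range (r + 1), ((j : ℤ) + 1) ^ (2 * r + 2) = S at *
  generalize ∑ j ∈ Finset.range (r + 1), ((j : ℤ) + 1) ^ (2 * r + 1) = T at *
  generalize ∑ k ∈ Finset.Icc 1 r, bernoulli (2 * k) / ((k : ℚ) * 2 ^ (2 * k)) = V at *
  have hcq : ∑ a ∈ Finset.range p, (a : ℚ) ^ (2 * r + 2) = 2 * S + p * T + (p : ℚ) ^ 2 * c := by
    exact_mod_cast congrArg (Int.cast : ℤ → ℚ) hc
  have hdq : ∑ a ∈ Finset.range p, (a : ℚ) ^ (2 * r + 2) =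
      2 * 2 ^ (2 * r + 2) * S + p * 2 ^ (2 * r + 1) * T + (p : ℚ) ^ 2 * d := by
    exact_mod_cast congrArg (Int.cast : ℤ → ℚ) hd
  have heq : 2 * (S : ℚ) = -1 + p * e := by exact_mod_cast he
  have hqq : (2 : ℚ) ^ (2 * r + 2) = 1 + p * q := by exact_mod_cast hq
  have hqh : (2 : ℚ) ^ (2 * r + 1) = (1 + p * q) / 2 := by
    rw [← hqq]
    ring
  rw [hqq, hqh] at hdq hL
  rw [hU] at hcq hdq
  have h2 : (((2 : ℕ) : ℚ)⁻¹) ∈ pIntegers p := inv_natCast_mem_pIntegers (by omega) (by omega)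
  have hmem : ((2 : ℕ) : ℚ)⁻¹ * (c + z - w - q * T) + (((2 : ℕ) : ℚ)⁻¹) ^ 2 * q - q * e - d ∈
      pIntegers p :=
    sub_mem (sub_mem (add_mem (mul_mem h2 (sub_mem (sub_mem (add_mem (intCast_mem _ _) hz) hw)
      (mul_mem (intCast_mem _ _) (intCast_mem _ _)))) (mul_mem (pow_mem h2 2) (intCast_mem _ _)))
      (mul_mem (intCast_mem _ _) (intCast_mem _ _))) (intCast_mem _ _)
  convert padicDvd_mul_of_mem_pIntegers 2 hmem using 1
  push_cast
  linear_combination (-1 / 2) * hL - (1 / 2) * hcq - (hdq - hcq) - p * q * heq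
end

section
/- Let p be an odd prime. Then Σ_{a odd, 1 ≤ a ≤ p−1} a^{p−1} ≡ 1/2 + p·B_{p−1} − 3p/8 − (p/4)·Σ_{k=1}^{(p−3)/2} B_{2k}/(k·2^{2k}) (mod p^2). -/
theorem Nat.Prime.dvd_choose_pred_sub_neg_one_pow {p : ℕ} (hp : p.Prime) {k : ℕ} (hk : k < p) :
    (p : ℤ) ∣ ((p - 1).choose k : ℤ) - (-1) ^ k := by
  induction k with
  | zero => simp
  | succ k ih =>
    obtain ⟨a, ha⟩ := ih (by omega)
    obtain ⟨b, hb⟩ := hp.dvd_choose_self (Nat.succ_ne_zero k) hk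
    obtain ⟨n, rfl⟩ : ∃ n, p = n + 1 := ⟨p - 1, by have := hp.pos; omega⟩
    rw [Nat.succ_eq_add_one, Nat.choose_succ_succ] at hb
    simp only [Nat.add_sub_cancel, Nat.succ_eq_add_one] at *
    zify at hb
    refine ⟨b - a, ?_⟩
    push_cast at *
    linear_combination hb - ha

/-- Modulo `p ^ 2`, the binomial coefficient `p.choose k` is `p * (-1) ^ (k + 1) / k`. -/
theorem Nat.Prime.sq_dvd_choose_sub {p : ℕ} (hp : p.Prime) {k : ℕ} (hk0 : k ≠ 0) (hk : k < p) :
    (p : ℤ) ^ 2 ∣ (p.choose k : ℤ) - p * ((-1) ^ (k + 1) * (k : ℤ) ^ (p - 2)) := by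
  obtain ⟨c, hc⟩ := hp.dvd_choose_self hk0 hk
  obtain ⟨a, ha⟩ := hp.dvd_choose_pred_sub_neg_one_pow (show k - 1 < p by omega)
  have hmul : (k : ℤ) * c = (p - 1).choose (k - 1) := by
    have h := Nat.add_one_mul_choose_eq (p - 1) (k - 1)
    rw [Nat.sub_add_cancel hp.one_le, Nat.sub_add_cancel (by omega), hc, mul_assoc] at h
    have := Nat.eq_of_mul_eq_mul_left hp.pos h
    rw [this]
    push_cast
    ring
  have hcop : IsCoprime (k : ℤ) p :=
    Nat.isCoprime_iff_coprime.2
      (hp.coprime_iff_not_dvd.2 (Nat.not_dvd_of_pos_of_lt (Nat.pos_of_ne_zero hk0) hk)).symm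
  obtain ⟨b, hb⟩ := (Int.ModEq.pow_card_sub_one_eq_one hp hcop).symm.dvd
  have hkpow : (k : ℤ) ^ (p - 1) = k ^ (p - 2) * k := by
    rw [← pow_succ]
    congr 1
    have := hp.two_le
    omega
  have hsign : (-1 : ℤ) ^ (k + 1) = (-1) ^ (k - 1) := by
    rw [show k + 1 = k - 1 + 2 by omega, pow_add]
    norm_num
  refine ⟨k ^ (p - 2) * a - c * b, ?_⟩
  rw [hc, hsign]
  push_cast
  rw [hkpow] at hb
  linear_combination (-(p : ℤ) * c) * hb + p * k ^ (p - 2) * (hmul + ha)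

theorem sq_dvd_sub_pow_sub {p a : ℕ} (hp : 2 ≤ p) (hodd : Odd p) :
    (p : ℤ) ^ 2 ∣ ((p : ℤ) - a) ^ (p - 1) - (a ^ (p - 1) + p * a ^ (p - 2)) := by
  obtain ⟨c, hc⟩ := Polynomial.powAddExpansion (-(a : ℤ)) (p : ℤ) (p - 1)
  have h1 : Even (p - 1) := hodd.tsub_odd odd_one
  have h2 : Odd (p - 2) := by
    obtain ⟨h, rfl⟩ := hodd
    exact ⟨h - 1, by omega⟩
  rw [show p - 1 - 1 = p - 2 by omega, h1.neg_pow, h2.neg_pow, neg_add_eq_sub,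
    Nat.cast_sub (by omega)] at hc
  refine ⟨c - a ^ (p - 2), ?_⟩
  push_cast at hc
  linear_combination hc

open Finset in
theorem Nat.Prime.sq_dvd_two_mul_alternating_sum_pow {p : ℕ} (hp : p.Prime) (hodd : Odd p) :
    (p : ℤ) ^ 2 ∣ 2 * ∑ a ∈ Ico 1 p, (-1 : ℤ) ^ (a + 1) * (a : ℤ) ^ (p - 1) - (2 - 2 ^ p) := by
  have hreflect : ∑ a ∈ Ico 1 p, (-1 : ℤ) ^ (a + 1) * (a : ℤ) ^ (p - 1) =
      ∑ a ∈ Ico 1 p, -((-1 : ℤ) ^ (a + 1) * ((p : ℤ) - a) ^ (p - 1)) := by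
    have h := sum_Ico_reflect (fun a : ℕ ↦ (-1 : ℤ) ^ (a + 1) * (a : ℤ) ^ (p - 1)) 1
      (Nat.le_succ p)
    rw [show p + 1 - p = 1 by omega, Nat.add_sub_cancel] at h
    rw [← h]
    refine sum_congr rfl fun a ha ↦ ?_
    rw [mem_Ico] at ha
    have hs : (-1 : ℤ) ^ (p - a + 1) = -(-1) ^ (a + 1) := by
      rcases Nat.even_or_odd a with h | h
      · rw [(Nat.Odd.sub_even ha.2.le hodd h).add_one.neg_one_pow, h.add_one.neg_one_pow, neg_neg]
      · rw [(Nat.Odd.sub_odd hodd h).add_one.neg_one_pow, h.add_one.neg_one_pow]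
    rw [hs, Nat.cast_sub ha.2.le]
    ring
  have hchoose : ∑ k ∈ Ico 1 p, (p.choose k : ℤ) = 2 ^ p - 2 := by
    have h := Nat.sum_range_choose p
    rw [sum_range_succ, range_eq_Ico, sum_eq_sum_Ico_succ_bot hp.pos] at h
    zify at h
    simp at h
    linarith
  have hsum : 2 * ∑ a ∈ Ico 1 p, (-1 : ℤ) ^ (a + 1) * (a : ℤ) ^ (p - 1) - (2 - 2 ^ p) =
      ∑ a ∈ Ico 1 p, (((p.choose a : ℤ) - p * ((-1) ^ (a + 1) * (a : ℤ) ^ (p - 2))) -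
        (-1) ^ (a + 1) * (((p : ℤ) - a) ^ (p - 1) - (a ^ (p - 1) + p * a ^ (p - 2)))) := by
    rw [two_mul]
    nth_rw 2 [hreflect]
    rw [← neg_sub ((2 : ℤ) ^ p) 2, ← hchoose, sub_neg_eq_add, ← sum_add_distrib,
      ← sum_add_distrib]
    refine sum_congr rfl fun a _ ↦ ?_
    ring
  rw [hsum]
  refine dvd_sum fun a ha ↦ _root_.dvd_sub ?_ (dvd_mul_of_dvd_right (sq_dvd_sub_pow_sub hp.two_le hodd) _)
  rw [mem_Ico] at ha
  exact hp.sq_dvd_choose_sub (by omega) ha.2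

/-- The subring of `p`-integral rational numbers. -/
noncomputable def pIntegralSubring (p : ℕ) [Fact p.Prime] : Subring ℚ :=
  (PadicInt.subring p).comap (Rat.castHom ℚ_[p])

theorem mem_pIntegralSubring {p : ℕ} [Fact p.Prime] {x : ℚ} :
    x ∈ pIntegralSubring p ↔ ‖(x : ℚ_[p])‖ ≤ 1 := Iff.rfl

theorem inv_natCast_mem_pIntegralSubring {p : ℕ} [Fact p.Prime] {k : ℕ} (hk : ¬ p ∣ k) :
    (k : ℚ)⁻¹ ∈ pIntegralSubring p := by
  rw [mem_pIntegralSubring]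
  push_cast
  rw [norm_inv, Padic.norm_natCast_eq_one_iff.2
    ((Fact.out : p.Prime).coprime_iff_not_dvd.2 hk), inv_one]

theorem padicDvd_of_eq_pow_mul {p k : ℕ} [hp : Fact p.Prime] {x r : ℚ}
    (hr : r ∈ pIntegralSubring p) (hx : x = p ^ k * r) : PadicDvd p k x := by
  rcases eq_or_ne r 0 with rfl | hr0
  · exact Or.inl (by simp [hx])
  refine Or.inr ?_
  have hp0 : (p : ℚ) ≠ 0 := Nat.cast_ne_zero.2 hp.out.ne_zero
  rw [hx, padicValRat.mul (pow_ne_zero _ hp0) hr0, padicValRat.pow,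
    padicValRat.self hp.out.one_lt]
  rw [mem_pIntegralSubring, Padic.eq_padicNorm, padicNorm.eq_zpow_of_nonzero hr0] at hr
  have h1 : (p : ℚ) ^ (-padicValRat p r) ≤ 1 := by exact_mod_cast hr
  rw [zpow_le_one_iff_right₀ (by exact_mod_cast hp.out.one_lt)] at h1
  linarith

open Finset in
theorem bernoulli_mem_pIntegralSubring {p : ℕ} [hp : Fact p.Prime] {n : ℕ} (hn : n + 1 < p) :
    bernoulli n ∈ pIntegralSubring p := by
  induction n using Nat.strong_induction_on with
  | _ n ih =>
    have h := sum_bernoulli (n + 1)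
    rw [sum_range_succ, Nat.choose_succ_self_right] at h
    have hn0 : ((n + 1 : ℕ) : ℚ) ≠ 0 := Nat.cast_ne_zero.2 (Nat.succ_ne_zero n)
    rw [← eq_sub_iff_add_eq', ← eq_inv_mul_iff_mul_eq₀ hn0] at h
    rw [h]
    refine mul_mem (inv_natCast_mem_pIntegralSubring (Nat.not_dvd_of_pos_of_lt n.succ_pos hn))
      (sub_mem ?_ (sum_mem fun k hk ↦ mul_mem (natCast_mem _ _) ?_))
    · split_ifs
      exacts [one_mem _, zero_mem _]
    · rw [mem_range] at hk
      exact ih k hk (by omega)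

open Finset in
theorem prime_mul_sum_range_pow (p n : ℕ) (hp : p.Prime) :
    (p : ℚ) * ∑ k ∈ range n, (k : ℚ) ^ (p - 1) =
      ∑ i ∈ range (p - 1), bernoulli i * (p.choose i) * (n : ℚ) ^ (p - i) +
        p * bernoulli (p - 1) * n := by
  have hp0 : (p : ℚ) ≠ 0 := Nat.cast_ne_zero.2 hp.ne_zero
  have hcast : ((p - 1 : ℕ) : ℚ) + 1 = p := by rw [Nat.cast_sub hp.one_le]; simp
  rw [sum_range_pow, ← sum_div, hcast, mul_div_cancel₀ _ hp0, sum_range_succ,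
    Nat.sub_add_cancel hp.one_le, ← Nat.choose_symm (Nat.sub_le p 1),
    Nat.sub_sub_self hp.one_le, Nat.choose_one_right, pow_one]
  ring

open Finset in
theorem exists_sum_range_pow_eq_prime_mul_bernoulli_add (p : ℕ) [hp : Fact p.Prime]
    (hodd : Odd p) : ∃ r ∈ pIntegralSubring p,
      ∑ k ∈ range p, (k : ℚ) ^ (p - 1) = p * bernoulli (p - 1) + p ^ 2 * r := by
  have hp0 : (p : ℚ) ≠ 0 := Nat.cast_ne_zero.2 hp.out.ne_zero
  have hterm : ∀ i ∈ range (p - 1), ∃ r ∈ pIntegralSubring p,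
      bernoulli i * (p.choose i) * (p : ℚ) ^ (p - i) = p ^ 3 * r := by
    intro i hi
    rw [mem_range] at hi
    have hB : bernoulli i ∈ pIntegralSubring p := bernoulli_mem_pIntegralSubring (by omega)
    rcases Nat.lt_or_ge (i + 2) p with h | h
    · refine ⟨bernoulli i * p.choose i * p ^ (p - i - 3),
        mul_mem (mul_mem hB (natCast_mem _ _)) (pow_mem (natCast_mem _ _) _), ?_⟩
      rw [show p - i = 3 + (p - i - 3) by omega, pow_add,
        show 3 + (p - i - 3) - 3 = p - i - 3 by omega]
      ring
    · have hi0 : i ≠ 0 := by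
        obtain ⟨m, rfl⟩ := hodd
        omega
      obtain ⟨c, hc⟩ := hp.out.dvd_choose_self hi0 (by omega)
      refine ⟨bernoulli i * c, mul_mem hB (natCast_mem _ _), ?_⟩
      rw [show p - i = 2 by omega, hc]
      push_cast
      ring
  choose! r hr hr' using hterm
  refine ⟨∑ i ∈ range (p - 1), r i, sum_mem hr, mul_left_cancel₀ hp0 ?_⟩
  rw [prime_mul_sum_range_pow p p hp.out, sum_congr rfl hr', ← mul_sum]
  ring

open Finset in
theorem sum_Ico_two_eq_sum_even {M : Type*} [AddCommMonoid M] (f : ℕ → M) (n : ℕ)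
    (hf : ∀ i, Odd i → 1 < i → f i = 0) :
    ∑ i ∈ Ico 2 (2 * n + 2), f i = ∑ k ∈ Icc 1 n, f (2 * k) := by
  induction n with
  | zero => simp
  | succ n ih =>
    rw [show 2 * (n + 1) + 2 = 2 * n + 2 + 1 + 1 by ring, sum_Ico_succ_top (by omega),
      sum_Ico_succ_top (by omega), ih, sum_Icc_succ_top (by omega),
      hf (2 * n + 2 + 1) ⟨n + 1, by ring⟩ (by omega), add_zero]
    rfl

open Finset in
theorem exists_prime_eq_two_pow_add_sum_bernoulli (p : ℕ) [hp : Fact p.Prime] (hodd : Odd p) :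
    ∃ r ∈ pIntegralSubring p,
      (p : ℚ) = 2 ^ p - p / 2 - p * ∑ k ∈ Icc 1 ((p - 3) / 2),
        bernoulli (2 * k) / ((k : ℚ) * 2 ^ (2 * k)) + 2 * (p * bernoulli (p - 1)) + p ^ 2 * r := by
  have hp3 : 3 ≤ p := by
    have := hp.out.two_le
    obtain ⟨h, rfl⟩ := hodd
    omega
  have h2 : ¬ p ∣ 2 := Nat.not_dvd_of_pos_of_lt two_pos hp3
  have hinv2 : ((2 : ℕ) : ℚ)⁻¹ ∈ pIntegralSubring p := inv_natCast_mem_pIntegralSubring h2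
  have hcop : IsCoprime ((2 : ℕ) : ℤ) p :=
    Nat.isCoprime_iff_coprime.2 (hp.out.coprime_iff_not_dvd.2 h2).symm
  obtain ⟨w, hw⟩ := (Int.ModEq.pow_card_sub_one_eq_one hp.out hcop).symm.dvd
  have hw' : (2 : ℚ) ^ (p - 1) = 1 + p * w := by
    rw [sub_eq_iff_eq_add'] at hw
    exact_mod_cast hw
  have hterm : ∀ k ∈ Icc 1 ((p - 3) / 2), ∃ r ∈ pIntegralSubring p,
      bernoulli (2 * k) * (p.choose (2 * k)) * (2 : ℚ) ^ (p - 2 * k) =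
        -(p * (bernoulli (2 * k) / ((k : ℚ) * 2 ^ (2 * k)))) + p ^ 2 * r := by
    intro k hk
    rw [mem_Icc] at hk
    have hB : bernoulli (2 * k) ∈ pIntegralSubring p := bernoulli_mem_pIntegralSubring (by omega)
    have hk0 : (k : ℚ) ≠ 0 := Nat.cast_ne_zero.2 (by omega)
    have hinv : (k : ℚ)⁻¹ ∈ pIntegralSubring p :=
      inv_natCast_mem_pIntegralSubring (Nat.not_dvd_of_pos_of_lt (by omega) (by omega))
    obtain ⟨z, hz⟩ := hp.out.dvd_choose_pred_sub_neg_one_pow (show 2 * k - 1 < p by omega)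
    have hsign : (-1 : ℤ) ^ (2 * k - 1) = -1 := Odd.neg_one_pow ⟨k - 1, by omega⟩
    have hz' : ((p - 1).choose (2 * k - 1) : ℚ) = -1 + p * z := by
      rw [hsign, sub_eq_iff_eq_add'] at hz
      exact_mod_cast hz
    have hmul : (p : ℚ) * (p - 1).choose (2 * k - 1) = p.choose (2 * k) * (2 * k) := by
      have h := Nat.add_one_mul_choose_eq (p - 1) (2 * k - 1)
      rw [Nat.sub_add_cancel hp.out.one_le, Nat.sub_add_cancel (by omega)] at h
      exact_mod_cast h
    have hpow : (2 : ℚ) ^ (p - 2 * k) * 2 ^ (2 * k) = 2 * 2 ^ (p - 1) := by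
      rw [← pow_add, ← pow_succ']
      congr 1
      omega
    rw [hz'] at hmul
    rw [hw'] at hpow
    refine ⟨bernoulli (2 * k) * (k : ℚ)⁻¹ * ((2 : ℕ) : ℚ)⁻¹ ^ (2 * k) * ((z : ℚ) - w + p * z * w),
      mul_mem (mul_mem (mul_mem hB hinv) (pow_mem hinv2 _)) (add_mem (sub_mem (intCast_mem _ _)
        (intCast_mem _ _)) (mul_mem (mul_mem (natCast_mem _ _) (intCast_mem _ _))
          (intCast_mem _ _))), ?_⟩
    have hc : (p.choose (2 * k) : ℚ) = p * (-1 + p * z) / (2 * k) := by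
      rw [eq_div_iff (by positivity), hmul]
    have hq : (2 : ℚ) ^ (p - 2 * k) = 2 * (1 + p * w) / 2 ^ (2 * k) := by
      rw [eq_div_iff (by positivity), hpow]
    rw [hc, hq, inv_pow]
    push_cast
    field_simp
    ring
  choose! r hr hr' using hterm
  have hzero : ∀ i, Odd i → 1 < i →
      bernoulli i * (p.choose i) * (2 : ℚ) ^ (p - i) = 0 := by
    intro i hi h1
    rw [bernoulli_eq_zero_of_odd hi h1]
    simp
  have h := prime_mul_sum_range_pow p 2 hp.out
  have hsplit : p - 1 = 2 * ((p - 3) / 2) + 2 := by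
    obtain ⟨h, rfl⟩ := hodd
    omega
  have hpow : (0 : ℚ) ^ (p - 1) = 0 := zero_pow (by omega)
  rw [range_eq_Ico (p - 1), sum_eq_sum_Ico_succ_bot (by omega),
    sum_eq_sum_Ico_succ_bot (by omega)] at h
  simp only [zero_add, Nat.reduceAdd, Nat.cast_ofNat] at h
  rw [show Ico 2 (p - 1) = Ico 2 (2 * ((p - 3) / 2) + 2) by rw [← hsplit],
    sum_Ico_two_eq_sum_even _ _ hzero, sum_congr rfl hr', sum_add_distrib, sum_neg_distrib,
    ← mul_sum, ← mul_sum, bernoulli_zero, bernoulli_one, hw', sum_range_succ, sum_range_one] at h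
  simp only [Nat.cast_zero, hpow, Nat.cast_one, one_pow, Nat.choose_zero_right, Nat.sub_zero,
    Nat.choose_one_right] at h
  refine ⟨∑ k ∈ Icc 1 ((p - 3) / 2), r k - w * ((2 : ℕ) : ℚ)⁻¹,
    sub_mem (sum_mem hr) (mul_mem (intCast_mem _ _) hinv2), ?_⟩
  push_cast
  linear_combination h

theorem sum_odd_p_sub_one_powers_mod_p_sq
    (p : ℕ) (hp : p.Prime) (hodd : Odd p) :
    PadicDvd p 2 ((∑ a ∈ (Finset.Icc 1 (p - 1)).filter (fun a => Odd a), (a : ℚ) ^ (p - 1)) -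
      (1 / 2 + (p : ℚ) * bernoulli (p - 1) - 3 * (p : ℚ) / 8 - ((p : ℚ) / 4) *
        ∑ k ∈ Finset.Icc 1 ((p - 3) / 2),
          bernoulli (2 * k) / ((k : ℚ) * 2 ^ (2 * k)))) := by
  have : Fact p.Prime := ⟨hp⟩
  have hp3 : 3 ≤ p := by
    have := hp.two_le
    obtain ⟨h, rfl⟩ := hodd
    omega
  obtain ⟨r, hr, hT⟩ := exists_sum_range_pow_eq_prime_mul_bernoulli_add p hodd
  obtain ⟨s, hs, hS⟩ := exists_prime_eq_two_pow_add_sum_bernoulli p hodd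
  obtain ⟨z, hz⟩ := hp.sq_dvd_two_mul_alternating_sum_pow hodd
  have hz' : 2 * ∑ a ∈ Finset.Ico 1 p, (-1 : ℚ) ^ (a + 1) * (a : ℚ) ^ (p - 1) - (2 - 2 ^ p) =
      p ^ 2 * z := by exact_mod_cast hz
  have hIcc : Finset.Icc 1 (p - 1) = Finset.Ico 1 p := by
    ext a
    simp only [Finset.mem_Icc, Finset.mem_Ico]
    omega
  have hoddsum : 2 * ∑ a ∈ (Finset.Icc 1 (p - 1)).filter (fun a => Odd a), (a : ℚ) ^ (p - 1) =
      ∑ a ∈ Finset.range p, (a : ℚ) ^ (p - 1) +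
        ∑ a ∈ Finset.Ico 1 p, (-1 : ℚ) ^ (a + 1) * (a : ℚ) ^ (p - 1) := by
    rw [hIcc, Finset.range_eq_Ico, Finset.sum_eq_sum_Ico_succ_bot hp.pos, Nat.cast_zero,
      zero_pow (by omega), zero_add, zero_add, ← Finset.sum_add_distrib, Finset.sum_filter,
      Finset.mul_sum]
    refine Finset.sum_congr rfl fun a _ ↦ ?_
    split_ifs with ha
    · rw [ha.add_one.neg_one_pow]
      ring
    · rw [(Nat.not_odd_iff_even.1 ha).add_one.neg_one_pow]
      ring
  have hinv : ((4 : ℕ) : ℚ)⁻¹ ∈ pIntegralSubring p := by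
    refine inv_natCast_mem_pIntegralSubring fun h ↦ ?_
    have := Nat.le_of_dvd two_pos (hp.dvd_of_dvd_pow (show p ∣ 2 ^ 2 from h))
    omega
  refine padicDvd_of_eq_pow_mul (r := ((4 : ℕ) : ℚ)⁻¹ * (2 * r + z + s)) (mul_mem hinv
    (add_mem (add_mem (mul_mem (natCast_mem _ 2) hr) (intCast_mem _ _)) hs)) ?_
  push_cast
  linear_combination (1 / 2) * hoddsum + (1 / 2) * hT + (1 / 4) * hz' + (1 / 4) * hS
end

section
/- Let p be an odd prime and let k be an integer with 1 < k ≤ (p−1)/2. Then Σ_{x odd, 1 ≤ x ≤ p−1} x^{2k−1} ≡ (1/2^{2k})·Σ_{m=0}^{2k−2} (−1)^m·E(2k−1, m) (mod p^2). -/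
open Finset Polynomial

lemma numAscents_eq_sum {n : ℕ} (σ : Equiv.Perm (Fin (n + 1))) :
    numAscents σ = ∑ i : Fin n, if σ i.castSucc < σ i.succ then 1 else 0 := by
  rw [numAscents, card_filter]
  rfl

lemma numAscents_le {n : ℕ} (σ : Equiv.Perm (Fin n)) : numAscents σ ≤ n - 1 :=
  (card_filter_le _ _).trans_eq (by simp)

/-- The permutation with first value `j` whose remaining values are ordered as those of `τ`. -/
noncomputable def consPerm {n : ℕ} (j : Fin (n + 1)) (τ : Equiv.Perm (Fin n)) :
    Equiv.Perm (Fin (n + 1)) :=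
  Equiv.ofBijective (Fin.cons j fun i => j.succAbove (τ i)) <|
    Finite.injective_iff_bijective.1 <| Fin.cons_injective_iff.2
      ⟨by rintro ⟨i, hi⟩; exact Fin.succAbove_ne _ _ hi,
        Fin.succAbove_right_injective.comp τ.injective⟩

@[simp] lemma consPerm_zero {n : ℕ} (j : Fin (n + 1)) (τ : Equiv.Perm (Fin n)) :
    consPerm j τ 0 = j := rfl

@[simp] lemma consPerm_succ {n : ℕ} (j : Fin (n + 1)) (τ : Equiv.Perm (Fin n)) (i : Fin n) :
    consPerm j τ i.succ = j.succAbove (τ i) := rfl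

lemma consPerm_bijective (n : ℕ) :
    Function.Bijective fun q : Fin (n + 1) × Equiv.Perm (Fin n) => consPerm q.1 q.2 := by
  rw [Fintype.bijective_iff_injective_and_card]
  refine ⟨?_, by simp [Fintype.card_perm, Nat.factorial_succ]⟩
  rintro ⟨j, τ⟩ ⟨j', τ'⟩ h
  obtain rfl : j = j' := by simpa using Equiv.congr_fun h 0
  refine Prod.ext rfl (Equiv.ext fun i => ?_)
  simpa using Equiv.congr_fun h i.succ

lemma numAscents_consPerm {n : ℕ} (j : Fin (n + 2)) (τ : Equiv.Perm (Fin (n + 1))) :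
    numAscents (consPerm j τ) = (if j ≤ (τ 0).castSucc then 1 else 0) + numAscents τ := by
  rw [numAscents_eq_sum, numAscents_eq_sum, Fin.sum_univ_succ]
  congr 1
  · simp only [Fin.castSucc_zero, consPerm_zero, consPerm_succ, Fin.lt_succAbove_iff_le_castSucc]
  · refine sum_congr rfl fun i _ => ?_
    simp only [← Fin.succ_castSucc, consPerm_succ, Fin.succAbove_lt_succAbove_iff]

/-- The sum of `(-1) ^ numAscents σ` over all permutations `σ` of `Fin n`. -/
def alternatingAscentSum (n : ℕ) : ℤ :=
  ∑ σ : Equiv.Perm (Fin n), (-1) ^ numAscents σ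

/-- The sum of `(-1) ^ numAscents σ` over the permutations `σ` with first value `j`. -/
def alternatingAscentSumFirst (n : ℕ) (j : Fin (n + 1)) : ℤ :=
  ∑ σ : Equiv.Perm (Fin (n + 1)) with σ 0 = j, (-1) ^ numAscents σ

lemma sum_alternatingAscentSumFirst (n : ℕ) :
    ∑ j, alternatingAscentSumFirst n j = alternatingAscentSum (n + 1) :=
  sum_fiberwise _ _ _

lemma alternatingAscentSumFirst_succ (n : ℕ) (j : Fin (n + 2)) :
    alternatingAscentSumFirst (n + 1) j =
      ∑ i, (if j ≤ i.castSucc then -1 else 1) * alternatingAscentSumFirst n i := by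
  have h : alternatingAscentSumFirst (n + 1) j =
      ∑ τ : Equiv.Perm (Fin (n + 1)),
        (if j ≤ (τ 0).castSucc then -1 else 1) * (-1) ^ numAscents τ := by
    rw [alternatingAscentSumFirst, sum_filter, ← (consPerm_bijective (n + 1)).sum_comp,
      Fintype.sum_prod_type]
    simp only [consPerm_zero]
    rw [sum_eq_single j (fun i _ hi => by simp [hi]) (by simp)]
    refine sum_congr rfl fun τ _ => ?_
    rw [numAscents_consPerm, pow_add]
    split_ifs <;> simp
  rw [h, ← sum_fiberwise univ fun τ : Equiv.Perm (Fin (n + 1)) => τ 0]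
  refine sum_congr rfl fun i _ => ?_
  rw [alternatingAscentSumFirst, mul_sum]
  refine sum_congr rfl fun τ hτ => ?_
  rw [(mem_filter.1 hτ).2]

lemma alternatingAscentSumFirst_zero (n : ℕ) :
    alternatingAscentSumFirst (n + 1) 0 = -alternatingAscentSum (n + 1) := by
  simp [alternatingAscentSumFirst_succ, ← sum_alternatingAscentSumFirst]

lemma alternatingAscentSumFirst_last (n : ℕ) :
    alternatingAscentSumFirst (n + 1) (Fin.last _) = alternatingAscentSum (n + 1) := by
  rw [alternatingAscentSumFirst_succ, ← sum_alternatingAscentSumFirst]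
  refine sum_congr rfl fun i _ => ?_
  rw [if_neg (Fin.castSucc_lt_last i).not_ge, one_mul]

lemma alternatingAscentSumFirst_succ_sub_castSucc (n : ℕ) (j : Fin (n + 1)) :
    alternatingAscentSumFirst (n + 1) j.succ - alternatingAscentSumFirst (n + 1) j.castSucc =
      2 * alternatingAscentSumFirst n j := by
  rw [alternatingAscentSumFirst_succ, alternatingAscentSumFirst_succ, ← sum_sub_distrib,
    sum_eq_single j]
  · simp [two_mul]
  · intro i _ hi
    have : j.succ ≤ i.castSucc ↔ j.castSucc ≤ i.castSucc := by
      rw [Fin.le_def, Fin.le_def]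
      have := Fin.val_ne_of_ne hi
      simp only [Fin.val_succ, Fin.val_castSucc]
      lia
    simp [this]
  · simp

/-- The integral polynomial `2 ^ n * Eₙ(X)`, where `Eₙ` is the `n`-th Euler polynomial, given by
its coordinates in the Bernstein basis. -/
noncomputable def scaledEulerPoly (n : ℕ) : ℤ[X] :=
  ∑ j : Fin (n + 1), C (alternatingAscentSumFirst n j) * bernsteinPolynomial ℤ n j

lemma scaledEulerPoly_zero : scaledEulerPoly 0 = 1 := by
  simp [scaledEulerPoly, bernsteinPolynomial, alternatingAscentSumFirst, numAscents,
    Subsingleton.elim _ (0 : Fin 1)]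

lemma derivative_scaledEulerPoly (n : ℕ) :
    derivative (scaledEulerPoly (n + 1)) = C (2 * (n + 1 : ℤ)) * scaledEulerPoly n := by
  have h : ∑ j : Fin (n + 2), C (alternatingAscentSumFirst (n + 1) j) *
        bernsteinPolynomial ℤ n j =
      ∑ j : Fin (n + 1), C (alternatingAscentSumFirst (n + 1) j.castSucc) *
        bernsteinPolynomial ℤ n j := by
    rw [Fin.sum_univ_castSucc]
    simp [bernsteinPolynomial.eq_zero_of_lt]
  rw [Fin.sum_univ_succ] at h
  have h2 : C (2 * (n + 1 : ℤ)) * scaledEulerPoly n = (n + 1 : ℤ[X]) *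
      (∑ j : Fin (n + 1), C (alternatingAscentSumFirst (n + 1) j.succ) *
        bernsteinPolynomial ℤ n j -
      ∑ j : Fin (n + 1), C (alternatingAscentSumFirst (n + 1) j.castSucc) *
        bernsteinPolynomial ℤ n j) := by
    rw [← sum_sub_distrib, scaledEulerPoly, mul_sum, mul_sum]
    refine sum_congr rfl fun j _ => ?_
    rw [← sub_mul, ← C_sub, alternatingAscentSumFirst_succ_sub_castSucc]
    simp only [C_mul, C_add, map_natCast, C_1]
    ring
  rw [h2, ← h, scaledEulerPoly, derivative_sum, Fin.sum_univ_succ]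
  simp only [derivative_C_mul, Fin.val_zero, Fin.val_succ, bernsteinPolynomial.derivative_zero,
    bernsteinPolynomial.derivative_succ, Nat.add_sub_cancel, mul_sub, sum_sub_distrib, mul_add,
    mul_sum]
  simp only [mul_left_comm (C _)]
  push_cast
  ring

lemma eval_zero_scaledEulerPoly (n : ℕ) :
    (scaledEulerPoly (n + 1)).eval 0 = -alternatingAscentSum (n + 1) := by
  rw [scaledEulerPoly, eval_finsetSum, Fin.sum_univ_succ]
  simp [bernsteinPolynomial.eval_at_0, alternatingAscentSumFirst_zero]

lemma eval_one_scaledEulerPoly (n : ℕ) :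
    (scaledEulerPoly (n + 1)).eval 1 = alternatingAscentSum (n + 1) := by
  rw [scaledEulerPoly, eval_finsetSum, Fin.sum_univ_castSucc]
  simp only [eval_mul, eval_C, bernsteinPolynomial.eval_at_1, Fin.val_castSucc, Fin.val_last,
    if_true, mul_one, alternatingAscentSumFirst_last, add_eq_right]
  exact sum_eq_zero fun j _ => by rw [if_neg j.is_lt.ne, mul_zero]

lemma eq_of_derivative_eq_of_eval_eq {f g : ℤ[X]} (h : derivative f = derivative g) (a : ℤ)
    (ha : f.eval a = g.eval a) : f = g := by
  have hd : derivative (f - g) = 0 := by rw [derivative_sub, h, sub_self]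
  have hc := eq_C_of_natDegree_eq_zero (derivative_eq_zero.1 hd)
  have he : (f - g).eval a = 0 := by rw [eval_sub, ha, sub_self]
  rw [hc, eval_C] at he
  rw [he, C_0] at hc
  exact sub_eq_zero.1 hc

lemma scaledEulerPoly_add_comp (n : ℕ) :
    scaledEulerPoly n + (scaledEulerPoly n).comp (X + 1) = C (2 ^ (n + 1)) * X ^ n := by
  induction n with
  | zero => simp [scaledEulerPoly_zero, one_add_one_eq_two]
  | succ n ih =>
    refine eq_of_derivative_eq_of_eval_eq ?_ 0 ?_
    · rw [derivative_add, derivative_comp, derivative_scaledEulerPoly, mul_comp, C_comp]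
      calc _ = C (2 * (n + 1 : ℤ)) *
            (scaledEulerPoly n + (scaledEulerPoly n).comp (X + 1)) := by
            simp; ring
        _ = _ := by
            rw [ih, derivative_C_mul, derivative_X_pow]
            simp only [map_mul, map_pow, map_add, map_natCast, map_one, map_ofNat]
            push_cast
            ring
    · simp [eval_zero_scaledEulerPoly, eval_one_scaledEulerPoly]

lemma scaledEulerPoly_comp_one_sub (n : ℕ) :
    (scaledEulerPoly n).comp (1 - X) = C ((-1) ^ n) * scaledEulerPoly n := by
  induction n with
  | zero => simp [scaledEulerPoly_zero]
  | succ n ih =>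
    set f := (scaledEulerPoly (n + 1)).comp (1 - X) - C ((-1) ^ (n + 1)) * scaledEulerPoly (n + 1)
      with hf
    have hd : derivative f = 0 := by
      rw [hf, derivative_sub, derivative_comp, derivative_C_mul, derivative_scaledEulerPoly,
        mul_comp, C_comp, ih]
      simp
      ring
    have hc := eq_C_of_natDegree_eq_zero (derivative_eq_zero.1 hd)
    have h0 : f.eval 0 = f.coeff 0 := by rw [hc]; simp
    have h1 : f.eval 1 = f.coeff 0 := by rw [hc]; simp
    have h : f.coeff 0 = 0 := by
      simp only [hf, eval_sub, eval_mul, eval_comp, eval_C, eval_one, eval_X, sub_zero, sub_self,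
        eval_zero_scaledEulerPoly, eval_one_scaledEulerPoly] at h0 h1
      simp only [hf]
      linarith
    rw [h, C_0] at hc
    exact sub_eq_zero.1 hc

lemma alternatingAscentSum_eq_zero_of_even {n : ℕ} (hn : Even n) (h0 : n ≠ 0) :
    alternatingAscentSum n = 0 := by
  obtain ⟨n, rfl⟩ := Nat.exists_eq_succ_of_ne_zero h0
  have h := congr_arg (eval 0) (scaledEulerPoly_comp_one_sub (n + 1))
  rw [Nat.succ_eq_add_one] at hn
  simp [hn.neg_one_pow, eval_zero_scaledEulerPoly, eval_one_scaledEulerPoly] at h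
  rw [Nat.succ_eq_add_one]
  linarith

lemma two_pow_mul_sum_neg_one_pow_mul_pow (n N : ℕ) :
    2 ^ (n + 1) * ∑ x ∈ range N, (-1 : ℤ) ^ x * (x : ℤ) ^ n =
      (scaledEulerPoly n).eval 0 - (-1) ^ N * (scaledEulerPoly n).eval (N : ℤ) := by
  induction N with
  | zero => simp
  | succ N ih =>
    have h := congr_arg (eval (N : ℤ)) (scaledEulerPoly_add_comp n)
    simp only [eval_add, eval_comp, eval_mul, eval_C, eval_pow, eval_X, eval_one] at h
    rw [sum_range_succ, mul_add, ih, pow_succ]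
    push_cast
    linear_combination -(-1) ^ N * h

/-- Alternating power sums with odd exponent modulo the square of an odd number. -/
lemma sq_dvd_two_pow_mul_alternating_sum_add {N n : ℕ} (hN : Odd N) (hn : Odd n) (hn1 : 1 < n) :
    (N : ℤ) ^ 2 ∣ 2 ^ (n + 1) * ∑ x ∈ range N, (-1 : ℤ) ^ x * (x : ℤ) ^ n +
      2 * alternatingAscentSum n := by
  obtain ⟨m, rfl⟩ : ∃ m, n = m + 2 := ⟨n - 2, by lia⟩
  have hm : Even (m + 1) := by simpa [Nat.odd_add_one, Nat.even_add_one] using hn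
  obtain ⟨c, hc⟩ := binomExpansion (scaledEulerPoly (m + 2)) 0 (N : ℤ)
  refine ⟨c, ?_⟩
  rw [zero_add, derivative_scaledEulerPoly, eval_mul, eval_zero_scaledEulerPoly,
    eval_zero_scaledEulerPoly, alternatingAscentSum_eq_zero_of_even hm (by simp)] at hc
  rw [two_pow_mul_sum_neg_one_pow_mul_pow, hN.neg_one_pow, hc, eval_zero_scaledEulerPoly]
  ring

lemma sq_dvd_sum_pow {p n : ℕ} (hp : p.Prime) (hodd : Odd p) (hn : Odd n) (hn1 : 1 < n)
    (hnp : n < p) : (p : ℤ) ^ 2 ∣ ∑ x ∈ range p, (x : ℤ) ^ n := by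
  have : Fact p.Prime := ⟨hp⟩
  obtain ⟨m, rfl⟩ : ∃ m, n = m + 1 := ⟨n - 1, by lia⟩
  have hm : Even m := by simpa [Nat.odd_add_one] using hn
  have h1 : (p : ℤ) ∣ ∑ x ∈ range p, (x : ℤ) ^ m := by
    rw [← ZMod.intCast_zmod_eq_zero_iff_dvd, ← FiniteField.sum_pow_lt_card_sub_one (ZMod p) m
      (by rw [ZMod.card]; lia)]
    push_cast
    refine sum_bij' (fun x _ => (x : ZMod p)) (fun x _ => x.val) (by simp)
      (fun x _ => mem_range.2 x.val_lt) (fun x hx => ZMod.val_cast_of_lt (mem_range.1 hx))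
      (fun x _ => ZMod.natCast_zmod_val x) (fun _ _ => rfl)
  have h2 : ∑ x ∈ range p, ((p : ℤ) - x) ^ (m + 1) =
      ∑ x ∈ range p, (x : ℤ) ^ (m + 1) + (p : ℤ) ^ (m + 1) := by
    have h3 := sum_range_succ (fun x : ℕ => (x : ℤ) ^ (m + 1)) p
    rw [← h3, sum_range_succ', ← sum_range_reflect (fun x : ℕ => ((x + 1 : ℕ) : ℤ) ^ (m + 1))]
    simp only [Nat.cast_zero, zero_pow (Nat.succ_ne_zero m), add_zero]
    refine sum_congr rfl fun x hx => ?_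
    have := mem_range.1 hx
    rw [Nat.sub_sub, Nat.cast_succ, Nat.cast_sub (by lia)]
    push_cast
    ring
  have h4 : ∀ x : ℤ, (p : ℤ) ^ 2 ∣ ((p : ℤ) - x) ^ (m + 1) + x ^ (m + 1) -
      (m + 1) * p * x ^ m := by
    intro x
    obtain ⟨c, hc⟩ := powAddExpansion (-x) (p : ℤ) (m + 1)
    refine ⟨c, ?_⟩
    rw [sub_eq_neg_add (p : ℤ) x, hc, hn.neg_pow, Nat.add_sub_cancel, hm.neg_pow]
    push_cast
    ring
  have h5 := dvd_sum (s := range p) fun x _ => h4 (x : ℤ)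
  rw [sum_sub_distrib, sum_add_distrib, h2, ← mul_sum] at h5
  have h6 : (p : ℤ) ^ 2 ∣ (m + 1) * p * ∑ x ∈ range p, (x : ℤ) ^ m := by
    obtain ⟨c, hc⟩ := h1
    exact ⟨(m + 1) * c, by rw [hc]; ring⟩
  have h7 : (p : ℤ) ^ 2 ∣ (p : ℤ) ^ (m + 1) := pow_dvd_pow _ (by lia)
  have h8 : (p : ℤ) ^ 2 ∣ 2 * ∑ x ∈ range p, (x : ℤ) ^ (m + 1) := by
    convert Int.dvd_sub (dvd_add h5 h6) h7 using 1
    ring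
  refine IsCoprime.dvd_of_dvd_mul_left (IsCoprime.pow_left ?_) h8
  exact Nat.isCoprime_iff_coprime.2 hodd.coprime_two_right

lemma sum_neg_one_pow_mul_eulerian {n : ℕ} (hn : n ≠ 0) :
    ∑ m ∈ range n, (-1 : ℤ) ^ m * eulerian n m = alternatingAscentSum n := by
  rw [alternatingAscentSum, ← sum_fiberwise_of_maps_to (t := range n) (g := numAscents)
    fun σ _ => mem_range.2 ((numAscents_le σ).trans_lt (by lia))]
  refine sum_congr rfl fun m _ => ?_
  rw [eulerian, sum_congr rfl fun σ hσ => by rw [(mem_filter.1 hσ).2], sum_const, nsmul_eq_mul,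
    mul_comm]

lemma sq_dvd_two_pow_mul_sum_odd_sub {p n : ℕ} (hp : p.Prime) (hodd : Odd p) (hn : Odd n)
    (hn1 : 1 < n) (hnp : n < p) :
    (p : ℤ) ^ 2 ∣ 2 ^ (n + 1) * ∑ x ∈ Icc 1 (p - 1) with Odd x, (x : ℤ) ^ n -
      alternatingAscentSum n := by
  have h1 := sq_dvd_two_pow_mul_alternating_sum_add hodd hn hn1
  have h2 := sq_dvd_sum_pow hp hodd hn hn1 hnp
  have hs : {x ∈ Icc 1 (p - 1) | Odd x} = {x ∈ range p | Odd x} := by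
    ext x
    simp only [mem_filter, mem_Icc, mem_range, and_congr_left_iff]
    intro hx
    have := hx.pos
    have := hp.pos
    lia
  have h3 : ∑ x ∈ range p, (x : ℤ) ^ n - ∑ x ∈ range p, (-1 : ℤ) ^ x * (x : ℤ) ^ n =
      2 * ∑ x ∈ Icc 1 (p - 1) with Odd x, (x : ℤ) ^ n := by
    rw [hs, sum_filter, mul_sum, ← sum_sub_distrib]
    refine sum_congr rfl fun x _ => ?_
    split_ifs with hx
    · rw [hx.neg_one_pow]; ring
    · rw [(Nat.not_odd_iff_even.1 hx).neg_one_pow]; ring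
  have h4 : (p : ℤ) ^ 2 ∣ 2 * (2 ^ (n + 1) * ∑ x ∈ Icc 1 (p - 1) with Odd x, (x : ℤ) ^ n -
      alternatingAscentSum n) := by
    convert Int.dvd_sub (h2.mul_left (2 ^ (n + 1))) h1 using 1
    linear_combination -2 ^ (n + 1) * h3
  refine IsCoprime.dvd_of_dvd_mul_left (IsCoprime.pow_left ?_) h4
  exact Nat.isCoprime_iff_coprime.2 hodd.coprime_two_right

lemma padicDvd_intCast_div {p k : ℕ} (hp : p.Prime) {a b : ℤ} (ha : (p : ℤ) ^ k ∣ a)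
    (hb : ¬(p : ℤ) ∣ b) : PadicDvd p k (a / b) := by
  have : Fact p.Prime := ⟨hp⟩
  obtain rfl | h0 := eq_or_ne a 0
  · left; simp
  · right
    have hb0 : b ≠ 0 := by rintro rfl; simp at hb
    rw [padicValRat.div (by exact_mod_cast h0) (by exact_mod_cast hb0), padicValRat.of_int,
      padicValRat.of_int, padicValInt.eq_zero_of_not_dvd hb, Nat.cast_zero, sub_zero, Nat.cast_le]
    exact ((padicValInt_dvd_iff k a).1 ha).resolve_left h0

theorem sum_odd_powers_eq_alternating_eulerian_sum_mod_p_sq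
    (p : ℕ) (hp : p.Prime) (hodd : Odd p) (k : ℕ) (hk1 : 1 < k) (hk2 : k ≤ (p - 1) / 2) :
    PadicDvd p 2 ((∑ x ∈ (Finset.Icc 1 (p - 1)).filter (fun x => Odd x),
        (x : ℚ) ^ (2 * k - 1)) -
      (1 / 2 ^ (2 * k)) *
        ∑ m ∈ Finset.range (2 * k - 1), (-1 : ℚ) ^ m * eulerian (2 * k - 1) m) := by
  have hn : Odd (2 * k - 1) := ⟨k - 1, by lia⟩
  have h := sq_dvd_two_pow_mul_sum_odd_sub hp hodd hn (by lia) (by lia)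
  rw [← sum_neg_one_pow_mul_eulerian (by lia), show 2 * k - 1 + 1 = 2 * k by lia] at h
  have hb : ¬(p : ℤ) ∣ 2 ^ (2 * k) := by
    intro hd
    have h2 : p ∣ 2 := hp.dvd_of_dvd_pow (by exact_mod_cast hd)
    rw [(Nat.prime_dvd_prime_iff_eq hp Nat.prime_two).1 h2] at hodd
    exact absurd hodd (by decide)
  convert padicDvd_intCast_div hp h hb using 1
  push_cast
  field_simp
end

section
/- Let p be an odd prime and let k be an integer with 1 ≤ k ≤ p−1. Then Σ_{l=1}^{p−2} B_l/(l·k^l) ≡ 0 (mod p) if and only if q_p(k) ≡ −w_p (mod p), where q_p(k) = (k^{p−1} − 1)/p is the Fermat quotient to base k. -/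
/-- The rational numbers whose denominator is prime to `p`, as a subring of `ℚ`. -/
noncomputable def pIntegralRat (p : ℕ) [Fact p.Prime] : Subring ℚ :=
  (PadicInt.subring p).comap (Rat.castHom ℚ_[p])

section

variable {p : ℕ} [Fact p.Prime]

lemma mem_pIntegralRat_iff {x : ℚ} : x ∈ pIntegralRat p ↔ padicNorm p x ≤ 1 := by
  rw [pIntegralRat, Subring.mem_comap, PadicInt.mem_subring_iff, eq_ratCast,
    Padic.eq_padicNorm]
  exact_mod_cast Iff.rfl

lemma padicDvd_one_iff {x : ℚ} : PadicDvd p 1 x ↔ ∃ c ∈ pIntegralRat p, x = p * c := by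
  have hp : (p : ℚ) ≠ 0 := by exact_mod_cast (Fact.out : p.Prime).ne_zero
  have h1 : (1 : ℚ) < p := by exact_mod_cast (Fact.out : p.Prime).one_lt
  have key : (∃ c ∈ pIntegralRat p, x = p * c) ↔ padicNorm p x ≤ (p : ℚ)⁻¹ := by
    constructor
    · rintro ⟨c, hc, rfl⟩
      rw [padicNorm.mul, padicNorm.padicNorm_p_of_prime]
      exact mul_le_of_le_one_right (by positivity) (mem_pIntegralRat_iff.1 hc)
    · intro h
      refine ⟨x / p, mem_pIntegralRat_iff.2 ?_, by field_simp⟩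
      rw [padicNorm.div, padicNorm.padicNorm_p_of_prime]
      exact div_le_one_of_le₀ h (by positivity)
  rw [key, PadicDvd]
  rcases eq_or_ne x 0 with rfl | hx
  · simp
  · rw [padicNorm.eq_zpow_of_nonzero hx, ← zpow_neg_one, zpow_le_zpow_iff_right₀ h1]
    simp [hx]

lemma inv_natCast_mem_pIntegralRat {n : ℕ} (hn : ¬ p ∣ n) : (n : ℚ)⁻¹ ∈ pIntegralRat p := by
  rw [mem_pIntegralRat_iff, ← one_div, padicNorm.div, padicNorm.one,
    (padicNorm.nat_eq_one_iff n).2 hn, div_one]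

lemma bernoulli'_mem_pIntegralRat {n : ℕ} (hn : n + 1 < p) : bernoulli' n ∈ pIntegralRat p := by
  induction n using Nat.strong_induction_on with
  | _ n ih =>
    rw [bernoulli'_def]
    refine sub_mem (one_mem _) (sum_mem fun i hi ↦ ?_)
    have hi' := Finset.mem_range.1 hi
    have hd : ((n : ℚ) - i + 1) = ((n - i + 1 : ℕ) : ℚ) := by
      push_cast [hi'.le]; ring
    rw [hd, div_eq_mul_inv]
    refine mul_mem (mul_mem (natCast_mem _ _) (inv_natCast_mem_pIntegralRat ?_))
      (ih i hi' (by omega))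
    exact Nat.not_dvd_of_pos_of_lt (by omega) (by omega)

lemma choose_prime_sub_one_modEq {i : ℕ} (hi : i < p) :
    (((p - 1).choose i : ℕ) : ℤ) ≡ (-1) ^ i [ZMOD p] := by
  induction i with
  | zero => simp
  | succ i ih =>
    have h := Nat.choose_succ_succ (p - 1) i
    have hp1 : (p - 1).succ = p := Nat.succ_pred_prime Fact.out
    rw [hp1] at h
    have hd : (p : ℤ) ∣ (p.choose i.succ : ℤ) := by
      exact_mod_cast (Fact.out : p.Prime).dvd_choose_self (by omega) hi
    have h' : ((p - 1).choose (i + 1) : ℤ) = p.choose i.succ - (p - 1).choose i := by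
      rw [h]; push_cast; simp
    rw [h', pow_succ, mul_neg_one, ← zero_sub]
    exact (Int.modEq_zero_iff_dvd.2 hd).sub (ih (by omega))

lemma exists_fermatQuotient {k : ℕ} (hk : ¬ p ∣ k) : ∃ q : ℤ, (k : ℚ) ^ (p - 1) = 1 + p * q := by
  have h : (k : ℤ) ^ (p - 1) ≡ 1 [ZMOD p] :=
    Int.ModEq.pow_card_sub_one_eq_one Fact.out
      ((Nat.isCoprime_iff_coprime).2 (((Fact.out : p.Prime).coprime_iff_not_dvd.2 hk).symm))
  obtain ⟨q, hq⟩ := h.symm.dvd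
  refine ⟨q, ?_⟩
  have : ((k : ℤ) ^ (p - 1) : ℚ) - 1 = p * q := by exact_mod_cast congrArg (Int.cast : ℤ → ℚ) hq
  push_cast at this
  linarith

lemma exists_wilsonQuotient : ∃ w : ℤ, ((p - 1).factorial : ℚ) = p * w - 1 := by
  have h : (((p - 1).factorial + 1 : ℤ) : ZMod p) = 0 := by
    push_cast; rw [ZMod.wilsons_lemma]; ring
  obtain ⟨w, hw⟩ := (ZMod.intCast_zmod_eq_zero_iff_dvd _ p).1 h
  refine ⟨w, ?_⟩
  have : ((p - 1).factorial + 1 : ℚ) = p * w := by exact_mod_cast congrArg (Int.cast : ℤ → ℚ) hw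
  linarith

/-- **Faulhaber's formula** with exponent `p - 1`, the extreme terms split off. -/
lemma prime_mul_sum_Ico_pow (n : ℕ) :
    (p : ℚ) * ∑ j ∈ Finset.Ico 1 (n + 1), (j : ℚ) ^ (p - 1) =
      n ^ p + p * bernoulli' (p - 1) * n + p * ∑ l ∈ Finset.Icc 1 (p - 2),
        bernoulli' l * ((p - 1).choose (l - 1) / l) * n ^ (p - l) := by
  obtain ⟨m, rfl⟩ : ∃ m, p = m + 2 := ⟨p - 2, by have := (Fact.out : p.Prime).two_le; omega⟩
  have hp : ((m : ℚ) + 1 + 1) ≠ 0 := by positivity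
  have hI : Finset.Icc 1 m = Finset.Ico (0 + 1) (m + 1) := rfl
  rw [show m + 2 - 1 = m + 1 from rfl, show m + 2 - 2 = m from rfl, sum_Ico_pow,
    Finset.sum_range_succ, Finset.sum_range_succ', hI, ← Finset.sum_Ico_add',
    ← Finset.range_eq_Ico]
  have hs : ∀ j ∈ Finset.range m,
      bernoulli' (j + 1) * ((m + 1 + 1).choose (j + 1) : ℚ) * (n : ℚ) ^ (m + 1 + 1 - (j + 1)) /
        ((m + 1 : ℕ) + 1) =
      bernoulli' (j + 1) * ((m + 1).choose (j + 1 - 1) / (j + 1 : ℕ)) *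
        (n : ℚ) ^ (m + 2 - (j + 1)) := by
    intro j _
    have h : ((m : ℚ) + 1 + 1) * (m + 1).choose j = (m + 1 + 1).choose (j + 1) * (j + 1) := by
      exact_mod_cast Nat.add_one_mul_choose_eq (m + 1) j
    have hj : ((j : ℚ) + 1) ≠ 0 := by positivity
    have h2 : ((m + 1).choose j : ℚ) / (j + 1) = (m + 1 + 1).choose (j + 1) / (m + 1 + 1) := by
      rw [div_eq_div_iff hj hp]; linarith
    push_cast
    simp only [h2]
    ring
  rw [Finset.sum_congr rfl hs]
  have hc : ((m + 1 + 1).choose (m + 1) : ℚ) = m + 1 + 1 := by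
    rw [Nat.choose_succ_self_right]; push_cast; ring
  rw [hc]
  simp only [bernoulli'_zero, Nat.choose_zero_right, Nat.sub_zero,
    show m + 1 + 1 - (m + 1) = 1 by omega]
  push_cast
  field_simp
  ring

lemma exists_prod_one_add_prime_mul {ι : Type*} (s : Finset ι) (f : ι → ℚ)
    (hf : ∀ i ∈ s, f i ∈ pIntegralRat p) :
    ∃ c ∈ pIntegralRat p, ∏ i ∈ s, (1 + p * f i) = 1 + p * ∑ i ∈ s, f i + p ^ 2 * c := by
  classical
  induction s using Finset.induction_on with
  | empty => exact ⟨0, zero_mem _, by simp⟩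
  | insert a s ha ih =>
    obtain ⟨c, hc, h⟩ := ih fun i hi ↦ hf i (Finset.mem_insert_of_mem hi)
    have hfa := hf a (Finset.mem_insert_self a s)
    have hfs : ∑ i ∈ s, f i ∈ pIntegralRat p :=
      sum_mem fun i hi ↦ hf i (Finset.mem_insert_of_mem hi)
    refine ⟨f a * ∑ i ∈ s, f i + c + p * (f a * c),
      add_mem (add_mem (mul_mem hfa hfs) hc) (mul_mem (natCast_mem _ _) (mul_mem hfa hc)), ?_⟩
    rw [Finset.prod_insert ha, Finset.sum_insert ha, h]
    ring

/-- **Lerch's formula**: the Fermat quotients add up to the Wilson quotient modulo `p`. -/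
lemma exists_sum_fermatQuotient_eq (hodd : Odd p) {q : ℕ → ℤ} {w : ℤ}
    (hq : ∀ j ∈ Finset.Ico 1 p, (j : ℚ) ^ (p - 1) = 1 + p * q j)
    (hw : ((p - 1).factorial : ℚ) = p * w - 1) :
    ∃ c ∈ pIntegralRat p, ∑ j ∈ Finset.Ico 1 p, (q j : ℚ) = w + p * c := by
  have hp : (p : ℚ) ≠ 0 := by exact_mod_cast (Fact.out : p.Prime).ne_zero
  obtain ⟨c, hc, h⟩ := exists_prod_one_add_prime_mul (p := p) (Finset.Ico 1 p)
    (fun j ↦ (q j : ℚ)) (fun j _ ↦ intCast_mem _ _)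
  obtain ⟨d, hd, h'⟩ := exists_prod_one_add_prime_mul (p := p) (Finset.range (p - 1))
    (fun _ ↦ -(w : ℚ)) (fun _ _ ↦ neg_mem (intCast_mem _ _))
  have hprod : ∏ j ∈ Finset.Ico 1 p, (1 + (p : ℚ) * q j) = ((p - 1).factorial : ℚ) ^ (p - 1) := by
    rw [← Finset.prod_congr rfl hq, Finset.prod_pow, ← Finset.prod_Ico_id_eq_factorial,
      Nat.sub_add_cancel (Fact.out : p.Prime).one_le]
    push_cast
    rfl
  have heven : Even (p - 1) := Nat.Odd.sub_odd hodd odd_one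
  rw [Finset.prod_const, Finset.sum_const, Finset.card_range, nsmul_eq_mul,
    Nat.cast_sub (Fact.out : p.Prime).one_le, Nat.cast_one] at h'
  rw [hprod, hw, ← heven.neg_pow, show -((p : ℚ) * w - 1) = 1 + p * -w by ring, h'] at h
  refine ⟨d - w - c, sub_mem (sub_mem hd (intCast_mem _ _)) hc, ?_⟩
  apply mul_left_cancel₀ hp
  linarith

/-- `bernoulli' l * (p - 1).choose (l - 1)` is congruent to `-bernoulli l` modulo `p`. -/
lemma exists_bernoulli'_mul_choose_eq {l : ℕ} (hl : 1 ≤ l) (hl' : l + 1 < p) :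
    ∃ c ∈ pIntegralRat p, bernoulli' l * (p - 1).choose (l - 1) = -bernoulli l + p * c := by
  obtain ⟨i, rfl⟩ : ∃ i, l = i + 1 := ⟨l - 1, by omega⟩
  obtain ⟨z, hz⟩ := (choose_prime_sub_one_modEq (p := p) (i := i) (by omega)).symm.dvd
  have hz' : ((p - 1).choose i : ℚ) - (-1) ^ i = p * z := by
    exact_mod_cast congrArg (Int.cast : ℤ → ℚ) hz
  refine ⟨bernoulli' (i + 1) * z,
    mul_mem (bernoulli'_mem_pIntegralRat hl') (intCast_mem _ _), ?_⟩
  rw [Nat.add_sub_cancel, eq_add_of_sub_eq hz', bernoulli, pow_succ]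
  ring

/-- **Glaisher's congruence** for `p * bernoulli' (p - 1)` modulo `p ^ 2`. -/
lemma exists_prime_mul_bernoulli'_eq (hodd : Odd p) {w : ℤ}
    (hw : ((p - 1).factorial : ℚ) = p * w - 1) :
    ∃ c ∈ pIntegralRat p, (p : ℚ) * bernoulli' (p - 1) = p - 1 + p * w + p ^ 2 * c := by
  have hp : (p : ℚ) ≠ 0 := by exact_mod_cast (Fact.out : p.Prime).ne_zero
  have hp3 : 3 ≤ p := by
    have := (Fact.out : p.Prime).two_le
    rcases hodd with ⟨t, rfl⟩; omega
  have hex : ∀ j, ∃ q : ℤ, j ∈ Finset.Ico 1 p → (j : ℚ) ^ (p - 1) = 1 + p * q := fun j ↦ by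
    by_cases hj : j ∈ Finset.Ico 1 p
    · rw [Finset.mem_Ico] at hj
      obtain ⟨q, hq⟩ := exists_fermatQuotient (p := p) (Nat.not_dvd_of_pos_of_lt hj.1 hj.2)
      exact ⟨q, fun _ ↦ hq⟩
    · exact ⟨0, fun h ↦ absurd h hj⟩
  choose q hq using hex
  obtain ⟨c, hc, hsum⟩ := exists_sum_fermatQuotient_eq hodd hq hw
  have hF := prime_mul_sum_Ico_pow (p := p) p
  have hT : ∃ t ∈ pIntegralRat p, ∑ l ∈ Finset.Icc 1 (p - 2),
      bernoulli' l * ((p - 1).choose (l - 1) / l) * (p : ℚ) ^ (p - l) = p ^ 2 * t := by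
    refine ⟨∑ l ∈ Finset.Icc 1 (p - 2),
      bernoulli' l * ((p - 1).choose (l - 1) * (l : ℚ)⁻¹) * (p : ℚ) ^ (p - l - 2),
      sum_mem fun l hl ↦ ?_, ?_⟩
    · rw [Finset.mem_Icc] at hl
      exact mul_mem (mul_mem (bernoulli'_mem_pIntegralRat (by omega)) (mul_mem (natCast_mem _ _)
        (inv_natCast_mem_pIntegralRat (Nat.not_dvd_of_pos_of_lt (by omega) (by omega)))))
        (pow_mem (natCast_mem _ _) _)
    · rw [Finset.mul_sum]
      refine Finset.sum_congr rfl fun l hl ↦ ?_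
      rw [Finset.mem_Icc] at hl
      obtain ⟨e, he⟩ : ∃ e, p - l = e + 2 := ⟨p - l - 2, by omega⟩
      rw [he, Nat.add_sub_cancel]
      ring
  obtain ⟨t, ht, hT⟩ := hT
  have hpow : (p : ℚ) ^ (p - 1) = p ^ 2 * p ^ (p - 3) := by
    rw [← pow_add]; congr 1; omega
  have hpow' : (p : ℚ) ^ p = p * (p ^ 2 * p ^ (p - 3)) := by
    rw [← hpow, ← pow_succ']; congr 1; omega
  rw [hT, Finset.sum_Ico_succ_top (by omega), Finset.sum_congr rfl hq, Finset.sum_add_distrib,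
    ← Finset.mul_sum, hsum, hpow, hpow', Finset.sum_const, Nat.card_Ico, nsmul_eq_mul,
    Nat.cast_sub (by omega), Nat.cast_one] at hF
  refine ⟨c - t, sub_mem hc ht, ?_⟩
  apply mul_left_cancel₀ hp
  linear_combination -hF

/-- `∑ B_l / (l k ^ l)` is the sum of the Fermat and Wilson quotients modulo `p`. -/
lemma exists_sum_bernoulli_div_eq (hodd : Odd p) {k : ℕ} (hk1 : 1 ≤ k) (hk2 : k < p) {q w : ℤ}
    (hq : (k : ℚ) ^ (p - 1) = 1 + p * q) (hw : ((p - 1).factorial : ℚ) = p * w - 1) :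
    ∃ c ∈ pIntegralRat p,
      ∑ l ∈ Finset.Icc 1 (p - 2), bernoulli l / ((l : ℚ) * (k : ℚ) ^ l) = q + w + p * c := by
  have hp : (p : ℚ) ≠ 0 := by exact_mod_cast (Fact.out : p.Prime).ne_zero
  have hk : (k : ℚ) ≠ 0 := by positivity
  have hkinv : (k : ℚ)⁻¹ ∈ pIntegralRat p :=
    inv_natCast_mem_pIntegralRat (Nat.not_dvd_of_pos_of_lt hk1 hk2)
  have hlinv : ∀ l ∈ Finset.Icc 1 (p - 2), (l : ℚ)⁻¹ ∈ pIntegralRat p := fun l hl ↦ by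
    rw [Finset.mem_Icc] at hl
    exact inv_natCast_mem_pIntegralRat (Nat.not_dvd_of_pos_of_lt (by omega) (by omega))
  obtain ⟨b, hb, hB⟩ := exists_prime_mul_bernoulli'_eq hodd hw
  have hkp : (k : ℚ) ^ p = k * (1 + p * q) := by
    rw [← hq, ← pow_succ', Nat.sub_add_cancel (Fact.out : p.Prime).one_le]
  have hpow : ∃ s ∈ pIntegralRat p,
      ∑ j ∈ Finset.Ico 1 (k + 1), (j : ℚ) ^ (p - 1) = k + p * s := by
    have hex : ∀ j ∈ Finset.Ico 1 (k + 1), ((j : ℚ) ^ (p - 1) - 1) / p ∈ pIntegralRat p := by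
      intro j hj
      rw [Finset.mem_Ico] at hj
      obtain ⟨r, hr⟩ := exists_fermatQuotient (p := p) (k := j)
        (Nat.not_dvd_of_pos_of_lt hj.1 (by omega))
      rw [hr, add_sub_cancel_left, mul_div_cancel_left₀ _ hp]
      exact intCast_mem _ _
    refine ⟨_, sum_mem hex, ?_⟩
    rw [Finset.mul_sum, 
      Finset.sum_congr rfl fun (j : ℕ) _ ↦ mul_div_cancel₀ ((j : ℚ) ^ (p - 1) - 1) hp,
      Finset.sum_sub_distrib]
    simp
  obtain ⟨s, hs, hpow⟩ := hpow
  set S := ∑ l ∈ Finset.Icc 1 (p - 2), bernoulli l / ((l : ℚ) * (k : ℚ) ^ l) with hS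
  have hSmem : S ∈ pIntegralRat p := by
    refine sum_mem fun l hl ↦ ?_
    have hl' := Finset.mem_Icc.1 hl
    rw [div_eq_mul_inv, mul_inv, ← inv_pow, bernoulli]
    exact mul_mem (mul_mem (pow_mem (neg_mem (one_mem _)) _)
      (bernoulli'_mem_pIntegralRat (by omega))) (mul_mem (hlinv l hl) (pow_mem hkinv _))
  have hT : ∃ t ∈ pIntegralRat p, ∑ l ∈ Finset.Icc 1 (p - 2),
      bernoulli' l * ((p - 1).choose (l - 1) / l) * (k : ℚ) ^ (p - l) = -k ^ p * S + p * t := by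
    have hex : ∀ l, ∃ c ∈ pIntegralRat p, l ∈ Finset.Icc 1 (p - 2) →
        bernoulli' l * (p - 1).choose (l - 1) = -bernoulli l + p * c := fun l ↦ by
      by_cases hl : l ∈ Finset.Icc 1 (p - 2)
      · have hl' := Finset.mem_Icc.1 hl
        obtain ⟨c, hc, h⟩ := exists_bernoulli'_mul_choose_eq (p := p) hl'.1 (by omega)
        exact ⟨c, hc, fun _ ↦ h⟩
      · exact ⟨0, zero_mem _, fun h ↦ absurd h hl⟩
    choose c hc hcl using hex
    refine ⟨∑ l ∈ Finset.Icc 1 (p - 2), c l * (l : ℚ)⁻¹ * (k : ℚ) ^ (p - l),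
      sum_mem fun l hl ↦ mul_mem (mul_mem (hc l) (hlinv l hl)) (pow_mem (natCast_mem _ _) _), ?_⟩
    rw [hS, Finset.mul_sum, Finset.mul_sum, ← Finset.sum_add_distrib]
    refine Finset.sum_congr rfl fun l hl ↦ ?_
    have hl' := Finset.mem_Icc.1 hl
    have hl0 : (l : ℚ) ≠ 0 := by exact_mod_cast (by omega : l ≠ 0)
    rw [← mul_div_assoc, hcl l hl, ← Nat.sub_add_cancel (show l ≤ p by omega), pow_add,
      Nat.add_sub_cancel]
    field_simp
  obtain ⟨t, ht, hT⟩ := hT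
  have hF := prime_mul_sum_Ico_pow (p := p) k
  rw [hpow, hT, hB, hkp] at hF
  refine ⟨b - q * S + t * (k : ℚ)⁻¹ - s * (k : ℚ)⁻¹,
    sub_mem (add_mem (sub_mem hb (mul_mem (intCast_mem _ _) hSmem)) (mul_mem ht hkinv))
      (mul_mem hs hkinv), ?_⟩
  apply mul_left_cancel₀ (mul_ne_zero hp hk)
  linear_combination hF + p ^ 2 * (s - t) * mul_inv_cancel₀ hk

end

theorem weighted_bernoulli_sum_zero_iff_fermat_quotient_eq_neg_wilson
    (p : ℕ) (hp : p.Prime) (hodd : Odd p) (k : ℕ) (hk1 : 1 ≤ k) (hk2 : k ≤ p - 1) :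
    PadicDvd p 1 (∑ l ∈ Finset.Icc 1 (p - 2), bernoulli l / ((l : ℚ) * (k : ℚ) ^ l)) ↔
    PadicDvd p 1 ((((k : ℚ) ^ (p - 1) - 1) / p) -
      (-((Nat.factorial (p - 1) + 1 : ℚ) / p))) := by
  have : Fact p.Prime := ⟨hp⟩
  have hp0 : (p : ℚ) ≠ 0 := by exact_mod_cast hp.ne_zero
  have hkp : k < p := by have := hp.pos; omega
  obtain ⟨q, hq⟩ := exists_fermatQuotient (p := p) (Nat.not_dvd_of_pos_of_lt hk1 hkp)
  obtain ⟨w, hw⟩ := exists_wilsonQuotient (p := p)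
  obtain ⟨c, hc, h⟩ := exists_sum_bernoulli_div_eq hodd hk1 hkp hq hw
  have hqw : ((k : ℚ) ^ (p - 1) - 1) / p - -((Nat.factorial (p - 1) + 1 : ℚ) / p) = q + w := by
    rw [hq, hw]
    field_simp
    ring
  rw [padicDvd_one_iff, padicDvd_one_iff, h, hqw]
  constructor
  · rintro ⟨d, hd, h'⟩
    exact ⟨d - c, sub_mem hd hc, by linear_combination h'⟩
  · rintro ⟨d, hd, h'⟩
    exact ⟨d + c, add_mem hd hc, by linear_combination h'⟩
end
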